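/- For all positive integers t ≥ 2, N and q, f_N*(q, tN - N, t) ≤ p_t(N,q); furthermore, (N!/N^N)·f_N(Nq, tN - N, t) ≤ p_t(N,q). Consequently, for every odd N ≥ 3 and every ε > 0, p_3(N,q) > q^{⌈N/2⌉ - ε} for all sufficiently large q. -/

import Mathlib

/-- `M` is the representation matrix of a `PHF(N; n, q, t)`. -/
def IsPHFMat (N n q t : ℕ) (M : Fin N → Fin n → Fin q) : Prop :=
  (∀ x y : Fin n, (∀ i : Fin N, M i x = M i y) → x = y) ∧
  ∀ C : Finset (Fin n), C.card = t → ∃ i : Fin N, Set.InjOn (M i) ↑C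

/-- `p_t(N, q)`: the maximal `n` for which a `PHF(N; n, q, t)` exists. -/
noncomputable def pPHF (t N q : ℕ) : ℕ :=
  sSup {n | ∃ M : Fin N → Fin n → Fin q, IsPHFMat N n q t M}

/-- `f_r*(q, v, e)`: the maximum number of edges in an `r`-uniform `r`-partite
hypergraph with all parts of size `q` (edges are transversals, one vertex per
part) in which no `e` distinct edges span at most `v` vertices. -/
noncomputable def fStar (r q v e : ℕ) : ℕ :=
  sSup {n | ∃ E : Finset (Fin r → Fin q), E.card = n ∧
    ∀ E' ⊆ E, E'.card = e →
      v < (E'.biUnion fun f => Finset.univ.image fun i : Fin r => (i, f i)).card}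

/-- `f_r(n, v, e)`: the maximum number of edges in an `r`-uniform hypergraph on
`n` vertices in which no `e` distinct edges span at most `v` vertices. -/
noncomputable def fTuran (r n v e : ℕ) : ℕ :=
  sSup {m | ∃ E : Finset (Finset (Fin n)), E.card = m ∧ (∀ A ∈ E, A.card = r) ∧
    ∀ E' ⊆ E, E'.card = e → v < (E'.biUnion id).card}

section PHFProof

open Finset

lemma digits_zero (D : ℤ) (hD : 0 < D) : ∀ (d : ℕ) (c : Fin d → ℤ), (∀ i, |c i| < D) →
    ∑ i, c i * D ^ (i : ℕ) = 0 → ∀ i, c i = 0 := by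
  intro d
  induction d with
  | zero => intro c _ _ i; exact i.elim0
  | succ d ih =>
    intro c hc hs
    rw [Fin.sum_univ_succ] at hs
    simp only [Fin.val_zero, pow_zero, mul_one, Fin.val_succ, pow_succ] at hs
    have e : ∑ i : Fin d, c i.succ * (D ^ (i : ℕ) * D) = D * ∑ i : Fin d, c i.succ * D ^ (i : ℕ) := by
      rw [Finset.mul_sum]; exact Finset.sum_congr rfl fun i _ => by ring
    rw [e] at hs
    have h0 : c 0 = 0 := by
      apply Int.eq_zero_of_abs_lt_dvd (m := D) _ (hc 0)
      exact ⟨-∑ i : Fin d, c i.succ * D ^ (i : ℕ), by linarith⟩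
    rw [h0, zero_add] at hs
    have h1 := ih (fun i => c i.succ) (fun i => hc _) ((mul_eq_zero.mp hs).resolve_left hD.ne')
    intro i
    refine Fin.cases h0 h1 i

lemma sphere_conv {d : ℕ} (x y z : Fin d → ℤ) (R a b : ℤ) (ha : a ≠ 0) (hb : b ≠ 0)
    (hab : a + b ≠ 0) (hx : ∑ i, x i ^ 2 = R) (hy : ∑ i, y i ^ 2 = R) (hz : ∑ i, z i ^ 2 = R)
    (h : ∀ i, a * (x i - y i) = b * (y i - z i)) : x = y := by
  have h1 : ∑ i, ((a + b) * y i) ^ 2 = ∑ i, (a * x i + b * z i) ^ 2 :=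
    Finset.sum_congr rfl fun i _ => by
      have := h i
      have e : (a + b) * y i = a * x i + b * z i := by linarith
      rw [e]
  have h2 : ∑ i, ((a + b) * y i) ^ 2 = (a + b) ^ 2 * R := by
    rw [← hy, Finset.mul_sum]; exact Finset.sum_congr rfl fun i _ => by ring
  have h3 : ∑ i, (a * x i + b * z i) ^ 2
      = (a + b) ^ 2 * R - a * b * ∑ i, (x i - z i) ^ 2 := by
    have e : (a + b) ^ 2 * R = (a ^ 2 + a * b) * ∑ i, x i ^ 2 + (b ^ 2 + a * b) * ∑ i, z i ^ 2 := by
      rw [hx, hz]; ring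
    rw [e, Finset.mul_sum, Finset.mul_sum, Finset.mul_sum, ← Finset.sum_add_distrib,
      ← Finset.sum_sub_distrib]
    exact Finset.sum_congr rfl fun i _ => by ring
  have h4 : a * b * ∑ i, (x i - z i) ^ 2 = 0 := by linarith
  have h5 := (mul_eq_zero.mp h4).resolve_left (mul_ne_zero ha hb)
  rw [Finset.sum_eq_zero_iff_of_nonneg (fun i _ => sq_nonneg _)] at h5
  funext i
  have h6 : x i - z i = 0 := by simpa using h5 i (Finset.mem_univ i)
  have h7 := h i
  have h8 : (a + b) * (x i - y i) = 0 := by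
    have : z i = x i := by linarith
    rw [this] at h7; linarith
  have := (mul_eq_zero.mp h8).resolve_left hab
  linarith

lemma behrend_set (C d m : ℕ) (hC : 1 ≤ C) (hm : 1 ≤ m) : ∃ S : Finset ℕ,
    (∀ x ∈ S, x ≤ d * ((2 * C + 1) * m) ^ d) ∧ m ^ d ≤ S.card * (d * m ^ 2 + 1) ∧
    ∀ a b : ℤ, |a| ≤ C → |b| ≤ C → a ≠ 0 → b ≠ 0 → a + b ≠ 0 →
      ∀ x ∈ S, ∀ y ∈ S, ∀ z ∈ S, a * ((x : ℤ) - y) = b * ((y : ℤ) - z) → x = y := by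
  classical
  set D : ℕ := (2 * C + 1) * m with hDdef
  have hDm : m ≤ D := by nlinarith
  have hD0 : 0 < D := by omega
  let X : (Fin d → Fin m) → ℕ := fun v => ∑ i, (v i : ℕ) * D ^ (i : ℕ)
  let nrm : (Fin d → Fin m) → ℕ := fun v => ∑ i, (v i : ℕ) ^ 2
  have hnrm : ∀ v ∈ (univ : Finset (Fin d → Fin m)), nrm v ∈ range (d * m ^ 2 + 1) := by
    intro v _
    rw [Finset.mem_range, Nat.lt_succ_iff]
    calc nrm v ≤ ∑ i : Fin d, m ^ 2 :=
          Finset.sum_le_sum fun i _ => Nat.pow_le_pow_left (v i).2.le 2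
      _ = d * m ^ 2 := by simp
  obtain ⟨R, hR⟩ : ∃ R, m ^ d ≤ (univ.filter fun v => nrm v = R).card * (d * m ^ 2 + 1) := by
    by_contra! hcon
    have h1 := Finset.card_eq_sum_card_fiberwise hnrm
    have h2 : (d * m ^ 2 + 1) * ∑ R ∈ range (d * m ^ 2 + 1), (univ.filter fun v => nrm v = R).card
        < (d * m ^ 2 + 1) * m ^ d := by
      rw [Finset.mul_sum]
      calc _ < ∑ R ∈ range (d * m ^ 2 + 1), m ^ d := by
            apply Finset.sum_lt_sum_of_nonempty (by simp)
            intro R _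
            rw [mul_comm]; exact hcon R
        _ = _ := by simp
    rw [← h1] at h2
    simp at h2
  have hXinj : Function.Injective X := by
    intro v w hvw
    have h0 := digits_zero D (by exact_mod_cast hD0) d (fun i => (v i : ℤ) - (w i : ℤ)) ?_ ?_
    · funext i
      have := h0 i
      apply Fin.ext; omega
    · intro i
      have := (v i).2; have := (w i).2
      rw [abs_lt]; constructor <;> omega
    · have : (X v : ℤ) = X w := by rw [hvw]
      simp only [X] at this
      push_cast at this
      simp only [sub_mul, Finset.sum_sub_distrib]
      linarith
  refine ⟨(univ.filter fun v => nrm v = R).image X, ?_, ?_, ?_⟩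
  · intro x hx
    obtain ⟨v, _, rfl⟩ := Finset.mem_image.mp hx
    calc X v ≤ ∑ i : Fin d, D ^ d := by
          apply Finset.sum_le_sum
          intro i _
          calc (v i : ℕ) * D ^ (i : ℕ) ≤ D * D ^ (i : ℕ) :=
                Nat.mul_le_mul_right _ ((v i).2.le.trans hDm)
            _ = D ^ ((i : ℕ) + 1) := by ring
            _ ≤ D ^ d := Nat.pow_le_pow_right hD0 i.2
      _ = _ := by simp
  · rw [Finset.card_image_of_injective _ hXinj]; exact hR
  · intro a b haC hbC ha hb hab x hx y hy z hz h
    obtain ⟨x, hx', rfl⟩ := Finset.mem_image.mp hx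
    obtain ⟨y, hy', rfl⟩ := Finset.mem_image.mp hy
    obtain ⟨z, hz', rfl⟩ := Finset.mem_image.mp hz
    simp only [Finset.mem_filter, Finset.mem_univ, true_and, nrm] at hx' hy' hz'
    have h0 := digits_zero D (by exact_mod_cast hD0) d
      (fun i => a * ((x i : ℤ) - (y i : ℤ)) - b * ((y i : ℤ) - (z i : ℤ))) ?_ ?_
    · have := sphere_conv (fun i => (x i : ℤ)) (fun i => (y i : ℤ)) (fun i => (z i : ℤ)) R a b
        ha hb hab (by exact_mod_cast hx') (by exact_mod_cast hy') (by exact_mod_cast hz')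
        (fun i => by have := h0 i; linarith)
      congr 1
      funext i
      have := congrFun this i
      apply Fin.ext; simpa using this
    · intro i
      have := (x i).2; have := (y i).2; have := (z i).2
      have e1 : |(x i : ℤ) - (y i : ℤ)| ≤ m := by rw [abs_le]; constructor <;> omega
      have e2 : |(y i : ℤ) - (z i : ℤ)| ≤ m := by rw [abs_le]; constructor <;> omega
      calc _ ≤ |a * ((x i : ℤ) - (y i : ℤ))| + |b * ((y i : ℤ) - (z i : ℤ))| := abs_sub _ _
        _ ≤ C * m + C * m := by
          rw [abs_mul, abs_mul]
          gcongr
        _ < D := by rw [hDdef]; push_cast; nlinarith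
    · simp only [X] at h
      push_cast at h
      have e : ∀ i, (a * ((x i : ℤ) - (y i : ℤ)) - b * ((y i : ℤ) - (z i : ℤ))) * (D : ℤ) ^ (i : ℕ)
        = (a * (x i * (D : ℤ) ^ (i : ℕ)) - a * (y i * (D : ℤ) ^ (i : ℕ)))
          - (b * (y i * (D : ℤ) ^ (i : ℕ)) - b * (z i * (D : ℤ) ^ (i : ℕ))) := fun i => by ring
      simp only [e, Finset.sum_sub_distrib, ← Finset.mul_sum]
      linarith

lemma le_pPHF (t N q : ℕ) (E : Finset (Fin N → Fin q))
    (hE : ∀ C ⊆ E, C.card = t → ∃ i : Fin N, Set.InjOn (fun f : Fin N → Fin q => f i) ↑C) :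
    E.card ≤ pPHF t N q := by
  classical
  apply le_csSup
  · refine ⟨q ^ N, ?_⟩
    rintro n ⟨M, hM, -⟩
    have : Function.Injective (fun (x : Fin n) (i : Fin N) => M i x) :=
      fun x y h => hM x y fun i => congrFun h i
    simpa using Fintype.card_le_of_injective _ this
  · let e := E.equivFin.symm
    refine ⟨fun i x => (e x : Fin N → Fin q) i, ?_, ?_⟩
    · intro x y h
      exact e.injective (Subtype.ext (funext h))
    · intro C hC
      have hinj : Function.Injective (fun x => (e x : Fin N → Fin q)) :=
        fun x y h => e.injective (Subtype.ext h)
      obtain ⟨i, hi⟩ := hE (C.image fun x => (e x : Fin N → Fin q)) (by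
        intro f hf
        obtain ⟨x, -, rfl⟩ := Finset.mem_image.mp hf
        exact (e x).2) (by rw [Finset.card_image_of_injective _ hinj, hC])
      refine ⟨i, fun x hx y hy h => hinj (hi ?_ ?_ h)⟩
      · exact Finset.mem_coe.mpr (Finset.mem_image_of_mem _ hx)
      · exact Finset.mem_coe.mpr (Finset.mem_image_of_mem _ hy)

lemma sep_of_span (t N q : ℕ) (ht : 2 ≤ t) (C : Finset (Fin N → Fin q)) (hC : C.card = t)
    (h : t * N - N < (C.biUnion fun f => Finset.univ.image fun i : Fin N => (i, f i)).card) :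
    ∃ i : Fin N, Set.InjOn (fun f : Fin N → Fin q => f i) ↑C := by
  classical
  by_contra! hcon
  have h1 : (C.biUnion fun f => Finset.univ.image fun i : Fin N => (i, f i)) ⊆
      ((Finset.univ : Finset (Fin N)).sigma (fun i => C.image fun f => f i)).image
        (fun p : (Σ _ : Fin N, Fin q) => (p.1, p.2)) := by
    intro p hp
    simp only [Finset.mem_biUnion, Finset.mem_image, Finset.mem_univ, true_and] at hp
    obtain ⟨f, hf, i, rfl⟩ := hp
    refine Finset.mem_image.mpr ⟨⟨i, f i⟩, ?_, rfl⟩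
    simp only [Finset.mem_sigma, Finset.mem_univ, true_and]
    exact Finset.mem_image_of_mem (fun f : Fin N → Fin q => f i) hf
  have h2 := (Finset.card_le_card h1).trans Finset.card_image_le
  rw [Finset.card_sigma] at h2
  have h3 : ∑ i : Fin N, (C.image fun f => f i).card ≤ ∑ i : Fin N, (t - 1) := by
    apply Finset.sum_le_sum
    intro i _
    have : (C.image fun f => f i).card ≤ C.card := Finset.card_image_le
    have : (C.image fun f => f i).card ≠ C.card := fun e => hcon i (Finset.card_image_iff.mp e)
    omega
  simp only [Finset.sum_const, Finset.card_univ, Fintype.card_fin, smul_eq_mul] at h3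
  have : t * N - N = N * (t - 1) := by rw [Nat.mul_sub, mul_comm]; simp
  omega

lemma part1 (t N q : ℕ) (ht : 2 ≤ t) : fStar N q (t * N - N) t ≤ pPHF t N q := by
  apply csSup_le
  · exact ⟨0, ∅, rfl, fun E' hE' hc => by
      rw [Finset.subset_empty.mp hE'] at hc; simp at hc; omega⟩
  · rintro n ⟨E, rfl, hE⟩
    exact le_pPHF t N q E fun C hC hc => sep_of_span t N q ht C hc (hE C hC hc)

lemma part2_aux (t N q : ℕ) (ht : 2 ≤ t) (E : Finset (Finset (Fin (N * q))))
    (hEN : ∀ A ∈ E, A.card = N)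
    (hE : ∀ E' ⊆ E, E'.card = t → t * N - N < (E'.biUnion id).card) :
    E.card * q ^ N ≤ pPHF t N q * (N * q).choose N := by
  classical
  let e : ((Fin N × Fin q) ≃ Fin (N * q)) → (Fin N → Fin q) → Finset (Fin (N * q)) :=
    fun s f => univ.image fun i => s (i, f i)
  have ecard : ∀ s f, (e s f).card = N := by
    intro s f
    rw [Finset.card_image_of_injective]
    · simp
    · intro i j h
      exact (Prod.ext_iff.mp (s.injective h)).1
  have einj : ∀ s, Function.Injective (e s) := by
    intro s f g h
    funext i
    have : s (i, f i) ∈ e s g := by rw [← h]; exact Finset.mem_image_of_mem _ (mem_univ _)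
    obtain ⟨j, -, hj⟩ := Finset.mem_image.mp this
    have := Prod.ext_iff.mp (s.injective hj)
    simp only at this
    obtain ⟨rfl, h2⟩ := this
    exact h2.symm
  let Dn : Finset (Fin (N * q)) → ℕ := fun A =>
    (univ.filter fun p : ((Fin N × Fin q) ≃ Fin (N * q)) × (Fin N → Fin q) => e p.1 p.2 = A).card
  have Dinv : ∀ A B : Finset (Fin (N * q)), A.card = N → B.card = N → Dn A ≤ Dn B := by
    intro A B hA hB
    obtain ⟨π, hπ⟩ : ∃ π : Equiv.Perm (Fin (N * q)), A.image π = B := by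
      let g : {x // x ∈ A} ≃ {x // x ∈ B} := Finset.equivOfCardEq (hA.trans hB.symm)
      refine ⟨g.extendSubtype, ?_⟩
      apply Finset.eq_of_subset_of_card_le
      · intro x hx
        obtain ⟨y, hy, rfl⟩ := Finset.mem_image.mp hx
        exact Equiv.extendSubtype_mem g y hy
      · rw [Finset.card_image_of_injective _ (Equiv.injective _), hA, hB]
    apply Finset.card_le_card_of_injOn (fun p => (p.1.trans π, p.2))
    · intro p hp
      simp only [Finset.coe_filter, Finset.mem_univ, true_and, Set.mem_ofPred_eq] at hp ⊢
      rw [← hπ, ← hp]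
      simp only [e, Finset.image_image]
      rfl
    · intro p _ p' _ h
      simp only [Prod.mk.injEq] at h
      refine Prod.ext (Equiv.ext fun x => π.injective ?_) h.2
      exact DFunLike.congr_fun h.1 x
  set M := Fintype.card ((Fin N × Fin q) ≃ Fin (N * q)) with hM
  have hM0 : 0 < M := Fintype.card_pos_iff.mpr ⟨finProdFinEquiv⟩
  -- total count
  have tot : ∑ A ∈ powersetCard N (univ : Finset (Fin (N * q))), Dn A = M * q ^ N := by
    rw [← Finset.card_eq_sum_card_fiberwise]
    · simp [hM]
    · intro p _
      simp [Finset.mem_powersetCard, ecard]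
  have hsum : ∑ A ∈ E, Dn A ≤ M * pPHF t N q := by
    have : ∑ A ∈ E, Dn A = ∑ s : ((Fin N × Fin q) ≃ Fin (N * q)),
        (univ.filter fun f => e s f ∈ E).card := by
      have h1 : ∑ A ∈ E, Dn A = (univ.filter fun p :
          ((Fin N × Fin q) ≃ Fin (N * q)) × (Fin N → Fin q) => e p.1 p.2 ∈ E).card := by
        rw [Finset.card_eq_sum_card_fiberwise (f := fun p => e p.1 p.2) (t := E)]
        · apply Finset.sum_congr rfl
          intro A hA
          simp only [Dn]
          congr 1
          ext p
          simp only [Finset.mem_filter, Finset.mem_univ, true_and]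
          constructor
          · rintro rfl; exact ⟨hA, rfl⟩
          · exact fun h => h.2
        · intro p hp
          simpa using hp
      rw [h1]
      simp only [Finset.card_filter, Fintype.sum_prod_type]
    rw [this]
    calc _ ≤ ∑ s : ((Fin N × Fin q) ≃ Fin (N * q)), pPHF t N q := by
          apply Finset.sum_le_sum
          intro s _
          apply le_pPHF
          intro C hC hc
          apply sep_of_span t N q ht C hc
          have h := hE (C.image (e s)) (by
            intro A hA
            obtain ⟨f, hf, rfl⟩ := Finset.mem_image.mp hA
            exact (Finset.mem_filter.mp (hC hf)).2)
            (by rw [Finset.card_image_of_injective _ (einj s), hc])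
          refine h.trans_le ?_
          have : ((C.image (e s)).biUnion id) =
            (C.biUnion fun f => Finset.univ.image fun i : Fin N => (i, f i)).image s := by
            rw [Finset.image_biUnion, Finset.biUnion_image]
            simp only [e, Finset.image_image, id]
            rfl
          rw [this]
          exact Finset.card_image_le
      _ = _ := by simp [hM]
  rcases E.eq_empty_or_nonempty with rfl | ⟨A0, hA0⟩
  · simp
  have h1 : ∑ A ∈ E, Dn A = E.card * Dn A0 := by
    rw [← smul_eq_mul (a := E.card), ← Finset.sum_const]
    exact Finset.sum_congr rfl fun A hA =>
      le_antisymm (Dinv _ _ (hEN _ hA) (hEN _ hA0)) (Dinv _ _ (hEN _ hA0) (hEN _ hA))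
  have h2 : ∑ A ∈ powersetCard N (univ : Finset (Fin (N * q))), Dn A
      = (N * q).choose N * Dn A0 := by
    have : (N * q).choose N = (powersetCard N (univ : Finset (Fin (N * q)))).card := by simp
    rw [this, ← smul_eq_mul (a := Finset.card _), ← Finset.sum_const]
    refine Finset.sum_congr rfl fun A hA => ?_
    have hA := (Finset.mem_powersetCard.mp hA).2
    exact le_antisymm (Dinv _ _ hA (hEN _ hA0)) (Dinv _ _ (hEN _ hA0) hA)
  rw [h1] at hsum
  rw [h2] at tot
  apply Nat.le_of_mul_le_mul_left _ hM0
  calc M * (E.card * q ^ N) = E.card * (M * q ^ N) := by ring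
    _ = (E.card * Dn A0) * (N * q).choose N := by rw [← tot]; ring
    _ ≤ (M * pPHF t N q) * (N * q).choose N := Nat.mul_le_mul_right _ hsum
    _ = _ := by ring

lemma part2 (t N q : ℕ) (ht : 2 ≤ t) (hN : 1 ≤ N) (hq : 1 ≤ q) :
    ((N.factorial : ℝ) / (N : ℝ) ^ N) * (fTuran N (N * q) (t * N - N) t : ℝ) ≤
        (pPHF t N q : ℝ) := by
  have hmem : fTuran N (N * q) (t * N - N) t ∈ {m | ∃ E : Finset (Finset (Fin (N * q))),
      E.card = m ∧ (∀ A ∈ E, A.card = N) ∧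
      ∀ E' ⊆ E, E'.card = t → t * N - N < (E'.biUnion id).card} := by
    apply Nat.sSup_mem
    · exact ⟨0, ∅, rfl, by simp, fun E' hE' hc => by
        rw [Finset.subset_empty.mp hE'] at hc; simp at hc; omega⟩
    · refine ⟨Fintype.card (Finset (Fin (N * q))), ?_⟩
      rintro m ⟨E, rfl, -⟩
      exact Finset.card_le_univ E
  obtain ⟨E, hc, hEN, hE⟩ := hmem
  rw [← hc]
  have h := part2_aux t N q ht E hEN hE
  have h' : (E.card : ℝ) * q ^ N ≤ pPHF t N q * ((N * q).choose N : ℝ) := by exact_mod_cast h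
  have hch : ((N * q).choose N : ℝ) ≤ ((N * q : ℕ) : ℝ) ^ N / N.factorial := Nat.choose_le_pow_div _ _
  have hf : (0 : ℝ) < N.factorial := by exact_mod_cast Nat.factorial_pos N
  have hq' : (0 : ℝ) < (q : ℝ) ^ N := by positivity
  have hN' : (0 : ℝ) < (N : ℝ) ^ N := by positivity
  rw [le_div_iff₀ hf] at hch
  push_cast at hch
  rw [mul_pow] at hch
  rw [div_mul_eq_mul_div, div_le_iff₀ hN']
  apply le_of_mul_le_mul_right _ hq'
  calc (N.factorial : ℝ) * E.card * q ^ N = N.factorial * (E.card * q ^ N) := by ring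
    _ ≤ N.factorial * (pPHF t N q * ((N * q).choose N : ℝ)) := by gcongr
    _ = pPHF t N q * (((N * q).choose N : ℝ) * N.factorial) := by ring
    _ ≤ pPHF t N q * ((N : ℝ) ^ N * q ^ N) := by gcongr
    _ = _ := by ring

/-- Sol: the difference polynomials of a bad triple of type `τ`. -/
def SolTriple (K : ℕ) (τ : Fin (2 * K + 1) → Fin 3) (u v : Polynomial ℚ) : Prop :=
  u.natDegree ≤ K ∧ v.natDegree ≤ K ∧ u ≠ 0 ∧ v ≠ 0 ∧ u + v ≠ 0 ∧
  ∀ i, (τ i = 0 → u.eval ((i : ℕ) : ℚ) = 0) ∧ (τ i = 1 → v.eval ((i : ℕ) : ℚ) = 0) ∧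
    (τ i = 2 → (u + v).eval ((i : ℕ) : ℚ) = 0)

lemma cast_inj_aux (n : ℕ) : Function.Injective (fun i : Fin n => ((i : ℕ) : ℚ)) := by
  intro i j h
  apply Fin.ext
  have h' : ((i : ℕ) : ℚ) = ((j : ℕ) : ℚ) := h
  exact_mod_cast h'

lemma sol_unique (K : ℕ) (τ : Fin (2 * K + 1) → Fin 3) (u v u1 v1 : Polynomial ℚ)
    (h : SolTriple K τ u v) (h1 : SolTriple K τ u1 v1) : u * v1 = u1 * v := by
  rw [← sub_eq_zero]
  apply Polynomial.eq_zero_of_degree_lt_of_eval_index_eq_zero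
    (s := (univ : Finset (Fin (2 * K + 1)))) (v := fun i : Fin (2 * K + 1) => ((i : ℕ) : ℚ))
    ((cast_inj_aux _).injOn)
  · obtain ⟨a1, a2, -⟩ := h
    obtain ⟨b1, b2, -⟩ := h1
    have : (u * v1 - u1 * v).natDegree ≤ 2 * K := by
      apply (Polynomial.natDegree_sub_le _ _).trans
      apply max_le
      · exact Polynomial.natDegree_mul_le.trans (by omega)
      · exact Polynomial.natDegree_mul_le.trans (by omega)
    refine (Polynomial.degree_le_of_natDegree_le this).trans_lt ?_
    simp only [Finset.card_univ, Fintype.card_fin]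
    exact_mod_cast Nat.lt_succ_self _
  · intro i _
    obtain ⟨-, -, -, -, -, hh⟩ := h
    obtain ⟨-, -, -, -, -, hh1⟩ := h1
    obtain ⟨p0, p1, p2⟩ := hh i
    obtain ⟨q0, q1, q2⟩ := hh1 i
    simp only [Polynomial.eval_sub, Polynomial.eval_mul, Polynomial.eval_add] at *
    have : τ i = 0 ∨ τ i = 1 ∨ τ i = 2 := by
      generalize τ i = s
      fin_cases s <;> simp
    rcases this with e | e | e
    · rw [p0 e, q0 e]; ring
    · rw [p1 e, q1 e]; ring
    · have e1 := p2 e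
      have e2 := q2 e
      linear_combination (Polynomial.eval ((i : ℕ) : ℚ) u) * e2 - (Polynomial.eval ((i : ℕ) : ℚ) u1) * e1

lemma code_data (K : ℕ) : ∃ (β : Fin (K + 1) → ℚ) (C : ℕ)
    (a b : (Fin (2 * K + 1) → Fin 3) → Fin (K + 1) → ℤ), Function.Injective β ∧ 1 ≤ C ∧
    (∀ τ j, |a τ j| ≤ C ∧ |b τ j| ≤ C ∧ a τ j ≠ 0 ∧ b τ j ≠ 0 ∧ a τ j + b τ j ≠ 0) ∧
    ∀ τ u v, SolTriple K τ u v → ∀ j, (a τ j : ℚ) * u.eval (β j) = b τ j * v.eval (β j) := by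
  classical
  have hrep : ∀ τ : Fin (2 * K + 1) → Fin 3, ∃ P Q : Polynomial ℚ, P ≠ 0 ∧ Q ≠ 0 ∧ P + Q ≠ 0 ∧
      ∀ u v, SolTriple K τ u v → u * Q = P * v := by
    intro τ
    by_cases h : ∃ P Q, SolTriple K τ P Q
    · obtain ⟨P, Q, hPQ⟩ := h
      exact ⟨P, Q, hPQ.2.2.1, hPQ.2.2.2.1, hPQ.2.2.2.2.1,
        fun u v huv => sol_unique K τ u v P Q huv hPQ⟩
    · push Not at h
      refine ⟨1, 1, one_ne_zero, one_ne_zero, ?_, fun u v huv => (h u v huv).elim⟩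
      norm_num
  choose P Q hP hQ hPQ hrel using hrep
  let R : Polynomial ℚ := ∏ τ, (P τ * Q τ * (P τ + Q τ))
  have hR : R ≠ 0 := Finset.prod_ne_zero_iff.mpr fun τ _ =>
    mul_ne_zero (mul_ne_zero (hP τ) (hQ τ)) (hPQ τ)
  have hinf : Set.Infinite {x : ℚ | R.eval x ≠ 0} := by
    have : Set.Finite {x : ℚ | R.IsRoot x} := Polynomial.finite_setOfPred_isRoot hR
    exact this.infinite_compl
  let emb := hinf.natEmbedding
  let β : Fin (K + 1) → ℚ := fun j => (emb (j : ℕ) : ℚ)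
  have hβ : Function.Injective β := by
    intro i j h
    exact Fin.ext (emb.injective (Subtype.ext h))
  have hβR : ∀ j τ, (P τ).eval (β j) ≠ 0 ∧ (Q τ).eval (β j) ≠ 0 ∧
      (P τ).eval (β j) + (Q τ).eval (β j) ≠ 0 := by
    intro j τ
    have h : R.eval (β j) ≠ 0 := (emb (j : ℕ)).2
    simp only [R, Polynomial.eval_prod] at h
    have := (Finset.prod_ne_zero_iff.mp h) τ (mem_univ _)
    simp only [Polynomial.eval_mul, Polynomial.eval_add] at this
    have h1 := mul_ne_zero_iff.mp this
    have h2 := mul_ne_zero_iff.mp h1.1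
    exact ⟨h2.1, h2.2, h1.2⟩
  let p : (Fin (2 * K + 1) → Fin 3) → Fin (K + 1) → ℚ := fun τ j => (P τ).eval (β j)
  let r : (Fin (2 * K + 1) → Fin 3) → Fin (K + 1) → ℚ := fun τ j => (Q τ).eval (β j)
  let a : (Fin (2 * K + 1) → Fin 3) → Fin (K + 1) → ℤ := fun τ j => (r τ j).num * (p τ j).den
  let b : (Fin (2 * K + 1) → Fin 3) → Fin (K + 1) → ℤ := fun τ j => (p τ j).num * (r τ j).den
  have ha : ∀ τ j, (a τ j : ℚ) = r τ j * ((p τ j).den * (r τ j).den) := by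
    intro τ j
    simp only [a]; push_cast
    have := Rat.mul_den_eq_num (r τ j)
    rw [← this]; ring
  have hb : ∀ τ j, (b τ j : ℚ) = p τ j * ((p τ j).den * (r τ j).den) := by
    intro τ j
    simp only [b]; push_cast
    have := Rat.mul_den_eq_num (p τ j)
    rw [← this]; ring
  have hden : ∀ τ j, (((p τ j).den : ℚ) * (r τ j).den) ≠ 0 := by
    intro τ j
    exact mul_ne_zero (by exact_mod_cast (p τ j).den_nz) (by exact_mod_cast (r τ j).den_nz)
  refine ⟨β, 1 + ∑ τ, ∑ j, ((a τ j).natAbs + (b τ j).natAbs), a, b, hβ, by omega, ?_, ?_⟩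
  · intro τ j
    have hle : (a τ j).natAbs + (b τ j).natAbs ≤
        ∑ τ, ∑ j, ((a τ j).natAbs + (b τ j).natAbs) :=
      (Finset.single_le_sum (f := fun j => (a τ j).natAbs + (b τ j).natAbs)
        (fun _ _ => Nat.zero_le _) (mem_univ j)).trans
      (Finset.single_le_sum (f := fun τ => ∑ j, ((a τ j).natAbs + (b τ j).natAbs))
        (fun _ _ => Nat.zero_le _) (mem_univ τ))
    obtain ⟨h1, h2, h3⟩ := hβR j τ
    refine ⟨?_, ?_, ?_, ?_, ?_⟩
    · rw [Int.abs_eq_natAbs]; exact_mod_cast (by omega)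
    · rw [Int.abs_eq_natAbs]; exact_mod_cast (by omega)
    · have : (a τ j : ℚ) ≠ 0 := by rw [ha]; exact mul_ne_zero h2 (hden τ j)
      exact_mod_cast this
    · have : (b τ j : ℚ) ≠ 0 := by rw [hb]; exact mul_ne_zero h1 (hden τ j)
      exact_mod_cast this
    · have : (a τ j : ℚ) + b τ j ≠ 0 := by
        rw [ha, hb, ← add_mul, add_comm]; exact mul_ne_zero h3 (hden τ j)
      exact_mod_cast this
  · intro τ u v huv j
    have h := congrArg (Polynomial.eval (β j)) (hrel τ u v huv)
    simp only [Polynomial.eval_mul] at h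
    rw [ha, hb]
    simp only [p, r]
    linear_combination (((P τ).eval (β j)).den * ((Q τ).eval (β j)).den : ℚ) * h

lemma code_exists (K : ℕ) : ∃ B C : ℕ, 1 ≤ C ∧ ∀ d m q : ℕ, 1 ≤ m →
    B * (d * ((2 * C + 1) * m) ^ d) + 1 ≤ q →
    ∃ n, n ≤ pPHF 3 (2 * K + 1) q ∧ (m ^ d) ^ (K + 1) ≤ n * (d * m ^ 2 + 1) ^ (K + 1) := by
  classical
  obtain ⟨β, C, a, b, hβ, hC, hab, hrel⟩ := code_data K
  let c : Fin (2 * K + 1) → Fin (K + 1) → ℚ := fun i j =>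
    (Lagrange.basis univ β j).eval ((i : ℕ) : ℚ)
  let W : ℕ := ∏ i, ∏ j, (c i j).den
  have hW : W ≠ 0 := Finset.prod_ne_zero_iff.mpr fun i _ =>
    Finset.prod_ne_zero_iff.mpr fun j _ => (c i j).den_nz
  have hz : ∀ i j, ∃ z : ℤ, (z : ℚ) = W * c i j := by
    intro i j
    have hd : (c i j).den ∣ W :=
      (Finset.dvd_prod_of_mem (fun j => (c i j).den) (mem_univ j)).trans
        (Finset.dvd_prod_of_mem (fun i => ∏ j, (c i j).den) (mem_univ i))
    obtain ⟨g, hg⟩ := hd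
    refine ⟨g * (c i j).num, ?_⟩
    rw [hg]; push_cast
    rw [← Rat.mul_den_eq_num (c i j)]; ring
  choose z hz using hz
  let B0 : ℕ := ∑ i, ∑ j, (z i j).natAbs
  refine ⟨2 * B0, C, hC, ?_⟩
  intro d m q hm hq
  obtain ⟨S, hS, hScard, hSfree⟩ := behrend_set C d m hC hm
  set T : ℕ := d * ((2 * C + 1) * m) ^ d with hT
  let msgs : Finset (Fin (K + 1) → ℕ) := Fintype.piFinset fun _ => S
  have hmsgs : ∀ x ∈ msgs, ∀ j, x j ∈ S := fun x hx => Fintype.mem_piFinset.mp hx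
  let lin : (Fin (K + 1) → ℕ) → Fin (2 * K + 1) → ℤ := fun x i => ∑ j, z i j * x j
  let poly : (Fin (K + 1) → ℕ) → Polynomial ℚ := fun x =>
    Lagrange.interpolate univ β (fun j => (x j : ℚ))
  have hpdeg : ∀ x, (poly x).natDegree ≤ K := by
    intro x
    have := Lagrange.degree_interpolate_lt (r := fun j => (x j : ℚ)) (s := univ) (hβ.injOn)
    simp only [Finset.card_univ, Fintype.card_fin] at this
    by_cases h0 : poly x = 0
    · rw [h0]; simp
    · exact Nat.lt_succ_iff.mp ((Polynomial.natDegree_lt_iff_degree_lt h0).mpr this)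
  have hpnode : ∀ x j, (poly x).eval (β j) = x j := by
    intro x j
    exact Lagrange.eval_interpolate_at_node _ hβ.injOn (mem_univ j)
  have hpeval : ∀ x i, (lin x i : ℚ) = W * (poly x).eval ((i : ℕ) : ℚ) := by
    intro x i
    simp only [lin, poly, Lagrange.interpolate_apply, Polynomial.eval_finsetSum,
      Polynomial.eval_mul, Polynomial.eval_C, Finset.mul_sum]
    push_cast
    refine Finset.sum_congr rfl fun j _ => ?_
    rw [hz]; simp only [c]; ring
  have hlineq : ∀ x y i, lin x i = lin y i →
      (poly x - poly y).eval ((i : ℕ) : ℚ) = 0 := by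
    intro x y i h
    have h1 := hpeval x i
    rw [h, hpeval y i] at h1
    have := mul_left_cancel₀ (by exact_mod_cast hW : (W : ℚ) ≠ 0) h1
    rw [Polynomial.eval_sub, this, sub_self]
  have hpinj : ∀ x y, poly x - poly y = 0 → x = y := by
    intro x y h
    funext j
    have h1 := hpnode x j
    rw [sub_eq_zero.mp h, hpnode y j] at h1
    exact_mod_cast h1.symm
  have hbound : ∀ x ∈ msgs, ∀ i, |lin x i| ≤ (B0 * T : ℕ) := by
    intro x hx i
    calc |lin x i| ≤ ∑ j, |z i j * x j| := Finset.abs_sum_le_sum_abs _ _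
      _ ≤ ∑ j, ((z i j).natAbs * T : ℤ) := by
        refine Finset.sum_le_sum fun j _ => ?_
        rw [abs_mul, Int.abs_eq_natAbs, Nat.abs_cast]
        have := hS _ (hmsgs x hx j)
        gcongr
      _ = ((∑ j, (z i j).natAbs : ℕ) : ℤ) * T := by push_cast; rw [Finset.sum_mul]
      _ ≤ (B0 * T : ℕ) := by
        have : ∑ j, (z i j).natAbs ≤ B0 :=
          Finset.single_le_sum (f := fun i => ∑ j, (z i j).natAbs)
            (fun _ _ => Nat.zero_le _) (mem_univ i)
        exact_mod_cast Nat.mul_le_mul_right T this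
  have hq0 : 0 < q := by omega
  let word : (Fin (K + 1) → ℕ) → Fin (2 * K + 1) → Fin q := fun x i =>
    ⟨(lin x i + (B0 * T : ℕ)).toNat % q, Nat.mod_lt _ hq0⟩
  have hword : ∀ x ∈ msgs, ∀ y ∈ msgs, ∀ i, word x i = word y i → lin x i = lin y i := by
    intro x hx y hy i h
    have h1 := abs_le.mp (hbound x hx i)
    have h2 := abs_le.mp (hbound y hy i)
    have h3 : (lin x i + (B0 * T : ℕ)).toNat % q = (lin y i + (B0 * T : ℕ)).toNat % q :=
      congrArg Fin.val h
    have hq' : 2 * (B0 * T) + 1 ≤ q := by rw [← mul_assoc]; exact hq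
    rw [Nat.mod_eq_of_lt (by omega), Nat.mod_eq_of_lt (by omega)] at h3
    omega
  have hwinj : Set.InjOn word msgs := by
    intro x hx y hy h
    apply hpinj
    apply Polynomial.eq_zero_of_degree_lt_of_eval_index_eq_zero
      (s := (univ : Finset (Fin (2 * K + 1)))) (v := fun i : Fin (2 * K + 1) => ((i : ℕ) : ℚ))
      ((cast_inj_aux _).injOn)
    · have : (poly x - poly y).natDegree ≤ K :=
        (Polynomial.natDegree_sub_le _ _).trans (max_le (hpdeg x) (hpdeg y))
      refine (Polynomial.degree_le_of_natDegree_le this).trans_lt ?_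
      simp only [Finset.card_univ, Fintype.card_fin]
      exact_mod_cast (by omega)
    · intro i _
      exact hlineq x y i (hword x hx y hy i (congrFun h i))
  -- key
  have key : ∀ x ∈ msgs, ∀ y ∈ msgs, ∀ w ∈ msgs, x ≠ y → y ≠ w → x ≠ w →
      ∃ i, word x i ≠ word y i ∧ word y i ≠ word w i ∧ word x i ≠ word w i := by
    intro x hx y hy w hw hxy hyw hxw
    by_contra! hcon
    have htau : ∀ i, ∃ s : Fin 3, (s = 0 → word x i = word y i) ∧ (s = 1 → word y i = word w i) ∧
        (s = 2 → word x i = word w i) := by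
      intro i
      by_cases e1 : word x i = word y i
      · exact ⟨0, by simp [e1]⟩
      by_cases e2 : word y i = word w i
      · exact ⟨1, by simp [e2]⟩
      · exact ⟨2, by simp [hcon i e1 e2]⟩
    choose τ hτ using htau
    have hadd : (poly x - poly y) + (poly y - poly w) = poly x - poly w := by ring
    have hsol : SolTriple K τ (poly x - poly y) (poly y - poly w) := by
      refine ⟨(Polynomial.natDegree_sub_le _ _).trans (max_le (hpdeg x) (hpdeg y)),
        (Polynomial.natDegree_sub_le _ _).trans (max_le (hpdeg y) (hpdeg w)),
        fun h => hxy (hpinj _ _ h), fun h => hyw (hpinj _ _ h), ?_, ?_⟩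
      · rw [hadd]; exact fun h => hxw (hpinj _ _ h)
      · intro i
        rw [hadd]
        exact ⟨fun h => hlineq _ _ _ (hword x hx y hy i ((hτ i).1 h)),
          fun h => hlineq _ _ _ (hword y hy w hw i ((hτ i).2.1 h)),
          fun h => hlineq _ _ _ (hword x hx w hw i ((hτ i).2.2 h))⟩
    apply hxy
    funext j
    have h := hrel τ _ _ hsol j
    simp only [Polynomial.eval_sub, hpnode] at h
    obtain ⟨g1, g2, g3, g4, g5⟩ := hab τ j
    exact hSfree _ _ g1 g2 g3 g4 g5 _ (hmsgs x hx j) _ (hmsgs y hy j) _ (hmsgs w hw j)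
      (by exact_mod_cast h)
  refine ⟨(msgs.image word).card, ?_, ?_⟩
  · apply le_pPHF
    intro D hD hDc
    obtain ⟨f1, f2, f3, h12, h13, h23, rfl⟩ := Finset.card_eq_three.mp hDc
    obtain ⟨x, hx, rfl⟩ := Finset.mem_image.mp (hD (by simp : f1 ∈ _))
    obtain ⟨y, hy, rfl⟩ := Finset.mem_image.mp (hD (by simp : f2 ∈ _))
    obtain ⟨w, hw, rfl⟩ := Finset.mem_image.mp (hD (by simp : f3 ∈ _))
    obtain ⟨i, e1, e2, e3⟩ := key x hx y hy w hw (fun h => h12 (by rw [h]))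
      (fun h => h23 (by rw [h])) (fun h => h13 (by rw [h]))
    refine ⟨i, ?_⟩
    intro f hf g hg hfg
    simp only [Finset.coe_insert, Finset.coe_singleton, Set.mem_insert_iff,
      Set.mem_singleton_iff] at hf hg
    rcases hf with rfl | rfl | rfl <;> rcases hg with rfl | rfl | rfl <;>
      first
      | rfl
      | exact absurd hfg e1
      | exact absurd hfg e2
      | exact absurd hfg e3
      | exact absurd hfg.symm e1
      | exact absurd hfg.symm e2
      | exact absurd hfg.symm e3
  · rw [Finset.card_image_of_injOn hwinj, Fintype.card_piFinset]
    simp only [Finset.prod_const, Finset.card_univ, Fintype.card_fin]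
    rw [← mul_pow]
    exact Nat.pow_le_pow_left hScard _

lemma part3 (K : ℕ) (ε : ℝ) (hε : 0 < ε) : ∃ q₀ : ℕ, ∀ q : ℕ, q₀ ≤ q →
      (q : ℝ) ^ (((K + 1 : ℕ) : ℝ) - ε) < (pPHF 3 (2 * K + 1) q : ℝ) := by
  obtain ⟨B, C, hC, hcode⟩ := code_exists K
  obtain ⟨d', hd'⟩ := exists_nat_gt (2 * (K + 1 : ℝ) / ε)
  set d := d' + 3 with hd
  have hdpos : (0 : ℝ) < d := by positivity
  have hdε : 2 * (K + 1 : ℝ) / d < ε := by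
    rw [div_lt_iff₀ hε] at hd'
    rw [div_lt_iff₀ hdpos, hd]
    push_cast
    nlinarith
  -- alphabet bound `A * m ^ d`
  set A : ℕ := B * (d * (2 * C + 1) ^ d) + 1 with hA
  have hA1 : 1 ≤ A := by omega
  have hAm : ∀ m : ℕ, 1 ≤ m → B * (d * ((2 * C + 1) * m) ^ d) + 1 ≤ A * m ^ d := by
    intro m hm
    have : 1 ≤ m ^ d := Nat.one_le_pow _ _ hm
    rw [hA, mul_pow, add_mul (B * _) 1, one_mul]
    have e : B * (d * ((2 * C + 1) ^ d * m ^ d)) = B * (d * (2 * C + 1) ^ d) * m ^ d := by ring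
    rw [e]
    exact Nat.add_le_add_left this _
  set s : ℝ := (K + 1 : ℝ) - 2 * (K + 1 : ℝ) / d with hs
  have hd3 : (3 : ℝ) ≤ d := by rw [hd]; push_cast; linarith [Nat.cast_nonneg (α := ℝ) d']
  have hs' : s = ((K + 1) * (d - 2 : ℝ)) / d := by rw [hs]; field_simp
  have hs0 : 0 ≤ s := by
    rw [hs']; apply div_nonneg _ hdpos.le
    apply mul_nonneg (by positivity); linarith
  set L : ℝ := ((A : ℝ) * 2 ^ d) ^ s * ((d : ℝ) + 1) ^ (K + 1) with hL
  have hL0 : 0 < L := by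
    have : (0 : ℝ) < A := by exact_mod_cast hA1
    positivity
  -- main inequality
  have main : ∀ q : ℕ, A ≤ q → (q : ℝ) ^ s ≤ L * (pPHF 3 (2 * K + 1) q : ℝ) := by
    intro q hq
    obtain ⟨m, hm, hmq, hqm⟩ : ∃ m : ℕ, 1 ≤ m ∧ A * m ^ d ≤ q ∧ q < A * (m + 1) ^ d := by
      have hex : ∃ m : ℕ, q < A * (m + 1) ^ d := by
        refine ⟨q, ?_⟩
        calc q < q + 1 := Nat.lt_succ_self _
          _ ≤ (q + 1) ^ d := Nat.le_self_pow (by omega) _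
          _ ≤ A * (q + 1) ^ d := Nat.le_mul_of_pos_left _ hA1
      classical
      have h1 := Nat.find_spec hex
      set m := Nat.find hex with hm
      have hm1 : 1 ≤ m := by
        by_contra hcon
        have : m = 0 := by omega
        rw [this] at h1
        simp at h1
        omega
      refine ⟨m, hm1, ?_, h1⟩
      have := Nat.find_min hex (m := m - 1) (by omega)
      rw [Nat.sub_add_cancel hm1] at this
      omega
    obtain ⟨n, hn, hnm⟩ := hcode d m q hm ((hAm m hm).trans hmq)
    have hm' : (1 : ℝ) ≤ m := by exact_mod_cast hm
    have hm0 : (0 : ℝ) < m := by linarith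
    have hq1 : (q : ℝ) ≤ (A * 2 ^ d) * (m : ℝ) ^ d := by
      have : q ≤ A * (2 * m) ^ d := hqm.le.trans (by gcongr; omega)
      rw [mul_pow] at this
      have h2 : (q : ℝ) ≤ A * (2 ^ d * m ^ d) := by exact_mod_cast this
      linarith
    have hn1 : ((m : ℝ) ^ d) ^ (K + 1) ≤ n * (((d : ℝ) + 1) ^ (K + 1) * ((m : ℝ) ^ 2) ^ (K + 1)) := by
      have h1 : ((m : ℝ) ^ d) ^ (K + 1) ≤ n * ((d : ℝ) * m ^ 2 + 1) ^ (K + 1) := by exact_mod_cast hnm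
      refine h1.trans ?_
      rw [← mul_pow]
      gcongr
      nlinarith
    have hms : ((m : ℝ) ^ d) ^ s ≤ n * ((d : ℝ) + 1) ^ (K + 1) := by
      have e : ((m : ℝ) ^ d) ^ s * ((m : ℝ) ^ 2) ^ (K + 1) = ((m : ℝ) ^ d) ^ (K + 1) := by
        rw [← Real.rpow_natCast (m : ℝ) d, ← Real.rpow_mul hm0.le, ← pow_mul, ← Real.rpow_natCast,
          ← Real.rpow_natCast, ← Real.rpow_add hm0, ← Real.rpow_mul hm0.le]
        congr 1
        rw [hs]
        push_cast
        field_simp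
        ring
      have hpos : (0 : ℝ) < ((m : ℝ) ^ 2) ^ (K + 1) := by positivity
      apply le_of_mul_le_mul_right _ hpos
      rw [e]; linarith
    calc (q : ℝ) ^ s ≤ ((A * 2 ^ d) * (m : ℝ) ^ d) ^ s := by
          apply Real.rpow_le_rpow (by positivity) hq1 hs0
      _ = (A * 2 ^ d : ℝ) ^ s * ((m : ℝ) ^ d) ^ s := Real.mul_rpow (by positivity) (by positivity)
      _ ≤ (A * 2 ^ d : ℝ) ^ s * (n * ((d : ℝ) + 1) ^ (K + 1)) := by gcongr
      _ = L * n := by rw [hL]; ring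
      _ ≤ L * (pPHF 3 (2 * K + 1) q : ℝ) := by
        gcongr
  have hlim : Filter.Tendsto (fun q : ℕ => (q : ℝ) ^ (ε - 2 * (K + 1 : ℝ) / d))
      Filter.atTop Filter.atTop :=
    (tendsto_rpow_atTop (by linarith)).comp tendsto_natCast_atTop_atTop
  obtain ⟨q1, hq1⟩ := Filter.eventually_atTop.mp (hlim.eventually_gt_atTop L)
  refine ⟨max q1 A, fun q hq => ?_⟩
  have h1 := hq1 q ((le_max_left _ _).trans hq)
  have h2 := main q ((le_max_right _ _).trans hq)
  have hq0 : (0 : ℝ) < q := by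
    have : A ≤ q := (le_max_right _ _).trans hq
    exact_mod_cast (by omega)
  have e : (q : ℝ) ^ s = (q : ℝ) ^ (ε - 2 * (K + 1 : ℝ) / d) * (q : ℝ) ^ (((K + 1 : ℕ) : ℝ) - ε) := by
    rw [← Real.rpow_add hq0]
    congr 1
    rw [hs]; push_cast; ring
  have hpos : (0 : ℝ) < (q : ℝ) ^ (((K + 1 : ℕ) : ℝ) - ε) := Real.rpow_pos_of_pos hq0 _
  rw [e] at h2
  have h3 := mul_lt_mul_of_pos_right h1 hpos
  exact lt_of_mul_lt_mul_left (h3.trans_le h2) hL0.le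

end PHFProof

theorem stmt_19 :
    (∀ t N q : ℕ, 2 ≤ t → 1 ≤ N → 1 ≤ q →
      fStar N q (t * N - N) t ≤ pPHF t N q) ∧
    (∀ t N q : ℕ, 2 ≤ t → 1 ≤ N → 1 ≤ q →
      ((N.factorial : ℝ) / (N : ℝ) ^ N) * (fTuran N (N * q) (t * N - N) t : ℝ) ≤
        (pPHF t N q : ℝ)) ∧
    (∀ N : ℕ, 3 ≤ N → Odd N → ∀ ε : ℝ, 0 < ε → ∃ q₀ : ℕ, ∀ q : ℕ, q₀ ≤ q →
      (q : ℝ) ^ ((((N + 1) / 2 : ℕ) : ℝ) - ε) < (pPHF 3 N q : ℝ)) := by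
  refine ⟨fun t N q ht _ _ => part1 t N q ht, fun t N q ht hN hq => part2 t N q ht hN hq, ?_⟩
  intro N _ hodd ε hε
  obtain ⟨K, rfl⟩ := hodd
  have e : (2 * K + 1 + 1) / 2 = K + 1 := by omega
  rw [e]
  exact part3 K ε hε
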